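/- arXiv:2110.15570 — 2 statements merged into one kernel-verified Lean document; each statement's English description precedes it below -/
import Mathlib

section
/- Let q be a prime power, ζ ∈ F_q nonzero, and define K_{ζ,n} = {(A,B) ∈ Mat_n(F_q)² : AB = ζBA}, U_{ζ,n} = {(A,B) ∈ K_{ζ,n} : A invertible}, N_{ζ,n} = {(A,B) ∈ K_{ζ,n} : A nilpotent}. Then for every n, |K_{ζ,n}| = Σ_{s+t=n} (|GL_n(F_q)| / (|GL_s(F_q)|·|GL_t(F_q)|)) · |N_{ζ,s}| · |U_{ζ,t}|. -/
open Matrix in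
theorem zc_rank_block {F S T : Type*} [Field F] [Fintype S] [Fintype T] [DecidableEq S]
    [DecidableEq T] (C : Matrix T T F) :
    (fromBlocks (0 : Matrix S S F) 0 0 C).rank = C.rank := by
  apply le_antisymm
  · have : fromBlocks (0 : Matrix S S F) 0 0 C
        = (fromRows (0 : Matrix S T F) 1) * (C * fromCols (0 : Matrix T S F) 1) := by
      rw [Matrix.mul_fromCols, Matrix.fromRows_mul]
      ext (i | i) (j | j) <;> simp
    rw [this]
    exact (rank_mul_le_right _ _).trans (rank_mul_le_left _ _)
  · have : C = (fromBlocks (0 : Matrix S S F) 0 0 C).submatrix Sum.inr Sum.inr := by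
      ext i j; simp
    conv_lhs => rw [this]
    exact rank_submatrix_le _ _ _

open Matrix in
theorem zc_isUnit_of_rank {F T : Type*} [Field F] [Fintype T] [DecidableEq T] (C : Matrix T T F)
    (h : C.rank = Fintype.card T) : IsUnit C := by
  rw [← Matrix.mulVec_surjective_iff_isUnit]
  have h2 : LinearMap.range C.mulVecLin = ⊤ := by
    apply Submodule.eq_top_of_finrank_eq
    rw [Module.finrank_fintype_fun_eq_card]; exact h
  exact LinearMap.range_eq_top.1 h2

open Matrix in
theorem zc_exists_basis {F S T : Type*} [Field F] [Fintype S] [Fintype T] [DecidableEq S]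
    [DecidableEq T] (M : Matrix (S ⊕ T) (S ⊕ T) F)
    (hM : IsCompl (LinearMap.ker (toLin' M)) (LinearMap.range (toLin' M)))
    (hr : M.rank = Fintype.card T) :
    ∃ (g : GL (S ⊕ T) F) (C : Matrix T T F), IsUnit C ∧
      M = g.1 * fromBlocks 0 0 0 C * (g⁻¹).1 := by
  have hrT : Module.finrank F (LinearMap.range (toLin' M)) = Fintype.card T := hr
  have hkS : Module.finrank F (LinearMap.ker (toLin' M)) = Fintype.card S := by
    have := LinearMap.finrank_range_add_finrank_ker (toLin' M)
    rw [hrT, Module.finrank_fintype_fun_eq_card, Fintype.card_sum] at this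
    omega
  let b1 : Module.Basis S F (LinearMap.ker (toLin' M)) :=
    (Module.finBasisOfFinrankEq F _ hkS).reindex (Fintype.equivFin S).symm
  let b2 : Module.Basis T F (LinearMap.range (toLin' M)) :=
    (Module.finBasisOfFinrankEq F _ hrT).reindex (Fintype.equivFin T).symm
  let b : Module.Basis (S ⊕ T) F (S ⊕ T → F) :=
    (b1.prod b2).map (Submodule.prodEquivOfIsCompl _ _ hM)
  let e := Pi.basisFun F (S ⊕ T)
  let g : GL (S ⊕ T) F := ⟨e.toMatrix b, b.toMatrix e, e.toMatrix_mul_toMatrix_flip b,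
    b.toMatrix_mul_toMatrix_flip e⟩
  let D := LinearMap.toMatrix b b (toLin' M)
  have hMD : M = g.1 * D * (g⁻¹).1 := by
    change M = e.toMatrix b * D * b.toMatrix e
    rw [basis_toMatrix_mul_linearMap_toMatrix_mul_basis_toMatrix]
    exact (LinearMap.toMatrix'_toLin' M).symm
  have hbl : ∀ i, b (Sum.inl i) = b1 i := by intro i; simp [b]
  have hbr : ∀ i, b (Sum.inr i) = b2 i := by intro i; simp [b]
  have hl : ∀ i j, D i (Sum.inl j) = 0 := by
    intro i j
    simp only [D, LinearMap.toMatrix_apply, hbl]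
    rw [LinearMap.mem_ker.1 (b1 j).2]; simp
  have hrr : ∀ i j, D (Sum.inl i) (Sum.inr j) = 0 := by
    intro i j
    simp only [D, LinearMap.toMatrix_apply]
    have : (toLin' M) (b (Sum.inr j)) = Submodule.prodEquivOfIsCompl _ _ hM
      (0, ⟨_, LinearMap.mem_range_self (toLin' M) (b (Sum.inr j))⟩) := by simp
    rw [this]
    simp only [b, Module.Basis.map_repr, LinearEquiv.trans_apply, LinearEquiv.symm_apply_apply]
    simp
  have hD : D = fromBlocks 0 0 0 D.toBlocks₂₂ := by
    ext (i | i) (j | j) <;> simp [hl, hrr, toBlocks₂₂]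
  refine ⟨g, D.toBlocks₂₂, ?_, by rw [← hD]; exact hMD⟩
  apply zc_isUnit_of_rank
  rw [← zc_rank_block (S := S), ← hD, ← hr]
  have hdet : ∀ u : GL (S ⊕ T) F, IsUnit u.1.det := fun u => (Matrix.isUnit_iff_isUnit_det _).1 u.isUnit
  rw [hMD, rank_mul_eq_left_of_isUnit_det _ _ (hdet _), rank_mul_eq_right_of_isUnit_det _ _ (hdet _)]

open Matrix in
theorem zc_isCompl {F I : Type*} [Field F] [Fintype I] [DecidableEq I] (A : Matrix I I F) :
    IsCompl (LinearMap.ker (toLin' (A ^ Fintype.card I)))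
      (LinearMap.range (toLin' (A ^ Fintype.card I))) := by
  rw [Matrix.toLin'_pow]
  set f := toLin' A
  set n := Fintype.card I with hn
  have hf : Module.finrank F (I → F) = n := Module.finrank_fintype_fun_eq_card F
  refine (Submodule.isCompl_iff_disjoint _ _ ?_).2 ?_
  · have := LinearMap.finrank_range_add_finrank_ker (f ^ n)
    omega
  · rw [Submodule.disjoint_def]
    rintro x hx ⟨y, rfl⟩
    have h2 : y ∈ LinearMap.ker (f ^ (n + n)) := by
      rw [pow_add]; simpa using hx
    rw [Module.End.ker_pow_eq_ker_pow_finrank_of_le (by omega), hf] at h2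
    exact h2

/-- nilpotent/invertible intertwiners vanish -/
theorem zc_inter0 {F S T : Type*} [Field F] [Fintype S] [Fintype T] [DecidableEq S]
    [DecidableEq T] (X : Matrix S T F) (N : Matrix S S F) (U : Matrix T T F) (c : F)
    (hN : IsNilpotent N) (hU : IsUnit U) (h : X * U = c • (N * X)) : X = 0 := by
  obtain ⟨k, hk⟩ := hN
  have key : ∀ m : ℕ, X * U ^ m = c ^ m • (N ^ m * X) := by
    intro m
    induction m with
    | zero => simp
    | succ m ih =>
      rw [pow_succ, ← Matrix.mul_assoc, ih, Matrix.smul_mul, Matrix.mul_assoc, h, pow_succ c,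
        pow_succ N]
      simp [Matrix.mul_assoc, smul_smul]
  have h1 := key k
  rw [hk] at h1
  obtain ⟨u, hu⟩ := hU.pow k
  have : X * u.1 * (u⁻¹).1 = 0 := by rw [hu, h1]; simp
  rwa [Matrix.mul_assoc, ← Units.val_mul, mul_inv_cancel, Units.val_one, Matrix.mul_one] at this

theorem zc_inter0' {F S T : Type*} [Field F] [Fintype S] [Fintype T] [DecidableEq S]
    [DecidableEq T] (X : Matrix T S F) (N : Matrix S S F) (U : Matrix T T F) (c : F)
    (hN : IsNilpotent N) (hU : IsUnit U) (h : U * X = c • (X * N)) : X = 0 := by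
  have hN' : IsNilpotent N.transpose := by
    obtain ⟨k, hk⟩ := hN
    exact ⟨k, by rw [← Matrix.transpose_pow, hk, Matrix.transpose_zero]⟩
  have := zc_inter0 X.transpose N.transpose U.transpose c hN' (by simpa using hU)
    (by rw [← Matrix.transpose_mul, h]; simp)
  simpa using this

/-- commuting (up to scalar) -/
theorem zc_block {F S T : Type*} [Field F] [Fintype S] [Fintype T] [DecidableEq S]
    [DecidableEq T] (X : Matrix (S ⊕ T) (S ⊕ T) F) (N N' : Matrix S S F) (U U' : Matrix T T F)
    (c : F) (hc : c ≠ 0)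
    (hN : IsNilpotent N) (hU : IsUnit U) (hN' : IsNilpotent N') (hU' : IsUnit U')
    (h : Matrix.fromBlocks N 0 0 U * X = c • (X * Matrix.fromBlocks N' 0 0 U')) :
    X = Matrix.fromBlocks X.toBlocks₁₁ 0 0 X.toBlocks₂₂ := by
  have h' := h
  rw [← Matrix.fromBlocks_toBlocks X, Matrix.fromBlocks_multiply, Matrix.fromBlocks_multiply,
    Matrix.fromBlocks_smul, Matrix.fromBlocks_inj] at h'
  simp only [Matrix.zero_mul, Matrix.mul_zero, add_zero, zero_add] at h'
  obtain ⟨-, h12, h21, -⟩ := h'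
  have e12 := zc_inter0 X.toBlocks₁₂ N U' c⁻¹ hN hU' (by rw [h12, smul_smul, inv_mul_cancel₀ hc, one_smul])
  have e21 := zc_inter0' X.toBlocks₂₁ N' U c hN' hU h21
  conv_lhs => rw [← Matrix.fromBlocks_toBlocks X, e12, e21]

/-- block diagonal unit -/
def zcDiag {F S T : Type*} [Field F] [Fintype S] [Fintype T] [DecidableEq S]
    [DecidableEq T] (h : GL S F × GL T F) : GL (S ⊕ T) F :=
  ⟨Matrix.fromBlocks h.1.1 0 0 h.2.1, Matrix.fromBlocks (h.1⁻¹).1 0 0 (h.2⁻¹).1,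
    by rw [Matrix.fromBlocks_multiply]; simp only [← Units.val_mul]; simp,
    by rw [Matrix.fromBlocks_multiply]; simp only [← Units.val_mul]; simp⟩

theorem zc_conj_comm {R F : Type*} [Field F] [Ring R] [Algebra F R] (c : F) (g : Rˣ) (a b : R)
    (h : a * b = c • (b * a)) :
    (g.1 * a * (g⁻¹).1) * (g.1 * b * (g⁻¹).1) =
      c • ((g.1 * b * (g⁻¹).1) * (g.1 * a * (g⁻¹).1)) := by
  have : ∀ a b : R, (g.1 * a * (g⁻¹).1) * (g.1 * b * (g⁻¹).1) = g.1 * (a * b) * (g⁻¹).1 := by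
    intro a b; simp [mul_assoc]
  rw [this, this, h]; simp

theorem zc_conj_nil {R : Type*} [Ring R] (g : Rˣ) (a : R) (h : IsNilpotent a) :
    IsNilpotent (g.1 * a * (g⁻¹).1) := by
  obtain ⟨k, hk⟩ := h
  exact ⟨k, by rw [Units.conj_pow, hk]; simp⟩

theorem zc_conj_unit {R : Type*} [Ring R] (g : Rˣ) (a : R) (h : IsUnit a) :
    IsUnit (g.1 * a * (g⁻¹).1) := (g.isUnit.mul h).mul (g⁻¹).isUnit

/-- nilpotent pairs -/
abbrev zcN {F : Type*} [Field F] (ζ : F) (S : Type*) [Fintype S] [DecidableEq S] :=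
  {p : Matrix S S F × Matrix S S F // p.1 * p.2 = ζ • (p.2 * p.1) ∧ IsNilpotent p.1}

/-- invertible pairs -/
abbrev zcU {F : Type*} [Field F] (ζ : F) (S : Type*) [Fintype S] [DecidableEq S] :=
  {p : Matrix S S F × Matrix S S F // p.1 * p.2 = ζ • (p.2 * p.1) ∧ IsUnit p.1}

/-- pairs of given stable rank -/
abbrev zcK {F : Type*} [Field F] (ζ : F) (I : Type*) [Fintype I] [DecidableEq I] (t : ℕ) :=
  {p : Matrix I I F × Matrix I I F // p.1 * p.2 = ζ • (p.2 * p.1) ∧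
    (p.1 ^ Fintype.card I).rank = t}

theorem zc_nil_pow {F S : Type*} [Field F] [Fintype S] [DecidableEq S] (A : Matrix S S F)
    (h : IsNilpotent A) (n : ℕ) (hn : Fintype.card S ≤ n) : A ^ n = 0 := by
  have h1 := Matrix.isNilpotent_charpoly_sub_pow_of_isNilpotent h
  have h2 : A.charpoly = Polynomial.X ^ Fintype.card S := sub_eq_zero.1 h1.eq_zero
  have h3 := A.aeval_self_charpoly
  rw [h2] at h3
  simp only [map_pow, Polynomial.aeval_X] at h3
  exact pow_eq_zero_of_le hn h3

section
variable {F S T : Type*} [Field F] [Fintype S] [Fintype T] [DecidableEq S] [DecidableEq T]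

theorem zc_diag_pow (A : Matrix S S F) (B : Matrix T T F) (n : ℕ) :
    (Matrix.fromBlocks A 0 0 B) ^ n = Matrix.fromBlocks (A ^ n) 0 0 (B ^ n) := by
  induction n with
  | zero => simp
  | succ n ih => rw [pow_succ, ih, Matrix.fromBlocks_multiply]; simp [pow_succ]

theorem zc_diag_comm (ζ : F) {A A' : Matrix S S F} {B B' : Matrix T T F} :
    Matrix.fromBlocks A 0 0 B * Matrix.fromBlocks A' 0 0 B' =
      ζ • (Matrix.fromBlocks A' 0 0 B' * Matrix.fromBlocks A 0 0 B) ↔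
    A * A' = ζ • (A' * A) ∧ B * B' = ζ • (B' * B) := by
  simp [Matrix.fromBlocks_multiply, Matrix.fromBlocks_smul, Matrix.fromBlocks_inj]

/-- the gluing map -/
def zcPhi (ζ : F) (x : GL (S ⊕ T) F × (zcN ζ S × zcU ζ T)) : zcK ζ (S ⊕ T) (Fintype.card T) :=
  ⟨(x.1.1 * Matrix.fromBlocks x.2.1.1.1 0 0 x.2.2.1.1 * (x.1⁻¹).1,
    x.1.1 * Matrix.fromBlocks x.2.1.1.2 0 0 x.2.2.1.2 * (x.1⁻¹).1), by
    obtain ⟨g, ⟨⟨a, a'⟩, ha, hn⟩, ⟨⟨b, b'⟩, hb, hu⟩⟩ := x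
    dsimp only at *
    refine ⟨zc_conj_comm _ _ _ _ ((zc_diag_comm ζ).2 ⟨ha, hb⟩), ?_⟩
    have hdet : ∀ u : GL (S ⊕ T) F, IsUnit u.1.det :=
      fun u => (Matrix.isUnit_iff_isUnit_det _).1 u.isUnit
    rw [Units.conj_pow, zc_diag_pow, zc_nil_pow a hn _ (by simp),
      Matrix.rank_mul_eq_left_of_isUnit_det _ _ (hdet _),
      Matrix.rank_mul_eq_right_of_isUnit_det _ _ (hdet _), zc_rank_block]
    exact Matrix.rank_of_isUnit _ (hu.pow _)⟩

theorem zc_surj (ζ : F) (hζ : ζ ≠ 0) : Function.Surjective (zcPhi (S := S) (T := T) ζ) := by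
  rintro ⟨⟨A, B⟩, hAB, hr⟩
  dsimp only at hAB hr
  obtain ⟨g, C, hC, hM⟩ := zc_exists_basis (S := S) (T := T) _ (zc_isCompl A) hr
  set n := Fintype.card (S ⊕ T)
  set A' := (g⁻¹).1 * A * g.1 with hA'
  set B' := (g⁻¹).1 * B * g.1 with hB'
  have hA'n : A' ^ n = Matrix.fromBlocks 0 0 0 C := by
    have := Units.conj_pow (g⁻¹) A n
    rw [inv_inv] at this
    rw [hA', this, hM]
    simp [mul_assoc]
  have hAB' : A' * B' = ζ • (B' * A') := by
    have := zc_conj_comm ζ g⁻¹ A B hAB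
    rwa [inv_inv] at this
  have hpow : ∀ m : ℕ, A' ^ m * B' = ζ ^ m • (B' * A' ^ m) := by
    intro m
    induction m with
    | zero => simp
    | succ m ih =>
      rw [pow_succ, mul_assoc, hAB', mul_smul_comm, ← mul_assoc, ih, smul_mul_assoc, smul_smul,
        pow_succ, mul_comm ζ, mul_assoc]
  have eA : A' = Matrix.fromBlocks A'.toBlocks₁₁ 0 0 A'.toBlocks₂₂ :=
    zc_block A' 0 0 C C 1 one_ne_zero IsNilpotent.zero hC IsNilpotent.zero hC (by
      rw [← hA'n, one_smul, ← pow_succ, ← pow_succ'])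
  have eB : B' = Matrix.fromBlocks B'.toBlocks₁₁ 0 0 B'.toBlocks₂₂ :=
    zc_block B' 0 0 C C (ζ ^ n) (pow_ne_zero _ hζ) IsNilpotent.zero hC IsNilpotent.zero hC (by
      rw [← hA'n, hpow])
  have hblk := hA'n
  rw [eA, zc_diag_pow, Matrix.fromBlocks_inj] at hblk
  have hcm := hAB'
  rw [eA, eB, zc_diag_comm] at hcm
  have hu : IsUnit A'.toBlocks₂₂ := by
    have h1 : IsUnit (A'.toBlocks₂₂ ^ n) := by rw [hblk.2.2.2]; exact hC
    by_cases hn : n = 0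
    · have : IsEmpty T := by
        have := Fintype.card_eq_zero_iff.1 hn
        exact ⟨fun x => this.elim (Sum.inr x)⟩
      exact isUnit_of_subsingleton _
    · exact (isUnit_pow_iff hn).1 h1
  refine ⟨(g, ⟨(A'.toBlocks₁₁, B'.toBlocks₁₁), hcm.1, n, hblk.1⟩,
    ⟨(A'.toBlocks₂₂, B'.toBlocks₂₂), hcm.2, hu⟩), ?_⟩
  apply Subtype.ext
  simp only [zcPhi]
  rw [← eA, ← eB, hA', hB']
  simp [mul_assoc]

/-- the action of the block diagonal group -/
def zcAct (ζ : F) (h : GL S F × GL T F) (x : GL (S ⊕ T) F × (zcN ζ S × zcU ζ T)) :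
    GL (S ⊕ T) F × (zcN ζ S × zcU ζ T) :=
  (x.1 * (zcDiag h)⁻¹,
    ⟨(h.1.1 * x.2.1.1.1 * (h.1⁻¹).1, h.1.1 * x.2.1.1.2 * (h.1⁻¹).1),
      zc_conj_comm _ _ _ _ x.2.1.2.1, zc_conj_nil _ _ x.2.1.2.2⟩,
    ⟨(h.2.1 * x.2.2.1.1 * (h.2⁻¹).1, h.2.1 * x.2.2.1.2 * (h.2⁻¹).1),
      zc_conj_comm _ _ _ _ x.2.2.2.1, zc_conj_unit _ _ x.2.2.2.2⟩)

theorem zc_diag_conj (h : GL S F × GL T F) (A : Matrix S S F) (B : Matrix T T F) :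
    Matrix.fromBlocks (h.1.1 * A * (h.1⁻¹).1) 0 0 (h.2.1 * B * (h.2⁻¹).1) =
      (zcDiag h).1 * Matrix.fromBlocks A 0 0 B * ((zcDiag h)⁻¹).1 := by
  change _ = Matrix.fromBlocks h.1.1 0 0 h.2.1 * Matrix.fromBlocks A 0 0 B *
    Matrix.fromBlocks (h.1⁻¹).1 0 0 (h.2⁻¹).1
  simp only [Matrix.fromBlocks_multiply]
  simp

theorem zc_phi_act (ζ : F) (h : GL S F × GL T F) (x : GL (S ⊕ T) F × (zcN ζ S × zcU ζ T)) :
    zcPhi ζ (zcAct ζ h x) = zcPhi ζ x := by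
  apply Subtype.ext
  simp only [zcPhi, zcAct, zc_diag_conj]
  simp [mul_assoc]

theorem zc_diag_inj : Function.Injective (zcDiag (F := F) (S := S) (T := T)) := by
  rintro ⟨a, b⟩ ⟨c, d⟩ h
  have := congrArg Units.val h
  simp only [zcDiag, Matrix.fromBlocks_inj] at this
  exact Prod.ext (Units.ext this.1) (Units.ext this.2.2.2)

theorem zc_phi_eq (ζ : F) (x y : GL (S ⊕ T) F × (zcN ζ S × zcU ζ T))
    (hxy : zcPhi ζ x = zcPhi ζ y) : ∃ h, zcAct ζ h x = y := by
  obtain ⟨g, ⟨⟨a, a'⟩, ha, hn⟩, ⟨⟨b, b'⟩, hb, hu⟩⟩ := x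
  obtain ⟨k, ⟨⟨c, c'⟩, hc, hn'⟩, ⟨⟨d, d'⟩, hd, hu'⟩⟩ := y
  have h0 := congrArg Subtype.val hxy
  simp only [zcPhi, Prod.mk.injEq] at h0
  obtain ⟨h1, h2⟩ := h0
  set u := k⁻¹ * g with hu0
  have conv : ∀ P Q : Matrix (S ⊕ T) (S ⊕ T) F, g.1 * P * (g⁻¹).1 = k.1 * Q * (k⁻¹).1 →
      Q * u.1 = u.1 * P := by
    intro P Q h
    have : (k⁻¹).1 * (g.1 * P * (g⁻¹).1) * g.1 = (k⁻¹).1 * (k.1 * Q * (k⁻¹).1) * g.1 := by rw [h]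
    simp only [mul_assoc, Units.inv_mul, Units.inv_mul_cancel_left, mul_one] at this
    rw [hu0, Units.val_mul, mul_assoc, ← this]
  have conv' : ∀ P Q : Matrix (S ⊕ T) (S ⊕ T) F, g.1 * P * (g⁻¹).1 = k.1 * Q * (k⁻¹).1 →
      P * (u⁻¹).1 = (u⁻¹).1 * Q := by
    intro P Q h
    have h3 := conv P Q h
    calc P * (u⁻¹).1 = (u⁻¹).1 * (u.1 * P) * (u⁻¹).1 := by simp
      _ = _ := by rw [← h3]; simp [mul_assoc]
  have eu := zc_block u.1 c a d b 1 one_ne_zero hn' hu' hn hu (by rw [one_smul]; exact conv _ _ h1)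
  have ev := zc_block (u⁻¹).1 a c b d 1 one_ne_zero hn hu hn' hu'
    (by rw [one_smul]; exact conv' _ _ h1)
  have m1 : u.1 * (u⁻¹).1 = 1 := by simp
  have m2 : (u⁻¹).1 * u.1 = 1 := by simp
  rw [eu, ev, Matrix.fromBlocks_multiply, ← Matrix.fromBlocks_one, Matrix.fromBlocks_inj] at m1 m2
  simp only [Matrix.mul_zero, add_zero, zero_add] at m1 m2
  let h : GL S F × GL T F := (⟨_, _, m1.1, m2.1⟩, ⟨_, _, m1.2.2.2, m2.2.2.2⟩)
  have hh : zcDiag h = u := Units.ext eu.symm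
  have fin : ∀ P Q : Matrix (S ⊕ T) (S ⊕ T) F, g.1 * P * (g⁻¹).1 = k.1 * Q * (k⁻¹).1 →
      u.1 * P * (u⁻¹).1 = Q := by
    intro P Q h
    rw [← conv P Q h]; simp [mul_assoc]
  have f1 := fin _ _ h1
  have f2 := fin _ _ h2
  rw [← hh, ← zc_diag_conj, Matrix.fromBlocks_inj] at f1 f2
  refine ⟨h, ?_⟩
  refine Prod.ext ?_ (Prod.ext (Subtype.ext (Prod.ext ?_ ?_)) (Subtype.ext (Prod.ext ?_ ?_)))
  · simp only [zcAct, hh, hu0]; group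
  · exact f1.1
  · exact f2.1
  · exact f1.2.2.2
  · exact f2.2.2.2

theorem zc_count [Finite F] (ζ : F) (hζ : ζ ≠ 0) :
    Nat.card (GL (S ⊕ T) F) * (Nat.card (zcN ζ S) * Nat.card (zcU ζ T)) =
      Nat.card (zcK ζ (S ⊕ T) (Fintype.card T)) * (Nat.card (GL S F) * Nat.card (GL T F)) := by
  rw [← Nat.card_prod, ← Nat.card_prod, ← Nat.card_prod, ← Nat.card_prod]
  symm
  choose σ hσ using zc_surj (S := S) (T := T) ζ hζ
  refine Nat.card_congr (Equiv.ofBijective (fun x => zcAct ζ x.2 (σ x.1)) ⟨?_, ?_⟩)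
  · rintro ⟨x, h⟩ ⟨y, k⟩ hxy
    dsimp only at hxy
    have e : x = y := by
      have := congrArg (zcPhi ζ) hxy
      rwa [zc_phi_act, zc_phi_act, hσ, hσ] at this
    subst e
    have := congrArg Prod.fst hxy
    simp only [zcAct] at this
    rw [zc_diag_inj (inv_injective (mul_left_cancel this))]
  · intro y
    obtain ⟨h, hh⟩ := zc_phi_eq ζ (σ (zcPhi ζ y)) y (hσ _)
    exact ⟨(zcPhi ζ y, h), hh⟩

end

theorem zc_K_congr {F I J : Type*} [Field F] [Fintype I] [Fintype J] [DecidableEq I]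
    [DecidableEq J] (ζ : F) (t : ℕ) (e : I ≃ J) : Nat.card (zcK ζ I t) = Nat.card (zcK ζ J t) := by
  refine Nat.card_congr (Equiv.subtypeEquiv
    ((Matrix.reindexAlgEquiv F F e).toEquiv.prodCongr (Matrix.reindexAlgEquiv F F e).toEquiv) ?_)
  rintro ⟨A, B⟩
  have h1 : Matrix.reindexAlgEquiv F F e A * Matrix.reindexAlgEquiv F F e B =
      ζ • (Matrix.reindexAlgEquiv F F e B * Matrix.reindexAlgEquiv F F e A) ↔
      A * B = ζ • (B * A) := by
    rw [← map_mul, ← map_mul, ← map_smul, EmbeddingLike.apply_eq_iff_eq]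
  have h2 : (Matrix.reindexAlgEquiv F F e A ^ Fintype.card J).rank =
      (A ^ Fintype.card I).rank := by
    rw [← map_pow, Fintype.card_congr e]
    exact Matrix.rank_reindex _ _ _
  exact and_congr h1.symm (by rw [← h2]; rfl)

theorem zc_total {F : Type*} [Field F] [Finite F] (ζ : F) (n : ℕ) :
    Nat.card {p : Matrix (Fin n) (Fin n) F × Matrix (Fin n) (Fin n) F //
        p.1 * p.2 = ζ • (p.2 * p.1)} =
      ∑ s ∈ Finset.range (n + 1), Nat.card (zcK ζ (Fin n) (n - s)) := by
  classical
  have := Fintype.ofFinite F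
  simp only [Nat.card_eq_fintype_card, Fintype.card_subtype]
  rw [Finset.card_eq_sum_card_fiberwise (f := fun p => (p.1 ^ n).rank)
    (t := Finset.range (n + 1)), ← Finset.sum_range_reflect]
  · refine Finset.sum_congr rfl fun s hs => ?_
    rw [Finset.filter_filter]
    simp
  · intro p _
    simp only [Finset.coe_range, Set.mem_Iio]
    exact Nat.lt_succ_of_le (by simpa using (p.1 ^ n).rank_le_card_width)

/-- Decomposition of the point count of the `ζ`-commuting variety:
`|K_{ζ,n}| = Σ_{s+t=n} (|GL_n| / (|GL_s|·|GL_t|)) · |N_{ζ,s}| · |U_{ζ,t}|`. -/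
theorem zeta_commuting_count_decomposition {F : Type*} [Field F] [Fintype F]
    (ζ : F) (hζ : ζ ≠ 0) (n : ℕ) :
    (Nat.card {p : Matrix (Fin n) (Fin n) F × Matrix (Fin n) (Fin n) F //
        p.1 * p.2 = ζ • (p.2 * p.1)} : ℚ) =
      ∑ s ∈ Finset.range (n + 1),
        ((Nat.card (GL (Fin n) F) : ℚ) /
            ((Nat.card (GL (Fin s) F) : ℚ) * (Nat.card (GL (Fin (n - s)) F) : ℚ))) *
          (Nat.card {p : Matrix (Fin s) (Fin s) F × Matrix (Fin s) (Fin s) F //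
            p.1 * p.2 = ζ • (p.2 * p.1) ∧ IsNilpotent p.1} : ℚ) *
          (Nat.card {p : Matrix (Fin (n - s)) (Fin (n - s)) F ×
              Matrix (Fin (n - s)) (Fin (n - s)) F //
            p.1 * p.2 = ζ • (p.2 * p.1) ∧ IsUnit p.1} : ℚ) := by
  rw [zc_total ζ n, Nat.cast_sum]
  refine Finset.sum_congr rfl fun s hs => ?_
  have hsn : s + (n - s) = n := by have := Finset.mem_range.1 hs; omega
  let e : Fin s ⊕ Fin (n - s) ≃ Fin n := finSumFinEquiv.trans (finCongr hsn)
  have h := zc_count (S := Fin s) (T := Fin (n - s)) ζ hζ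
  rw [zc_K_congr ζ _ e, Nat.card_congr (Units.mapEquiv (Matrix.reindexAlgEquiv F F e).toMulEquiv).toEquiv,
    Fintype.card_fin] at h
  have p1 : (Nat.card (GL (Fin s) F) : ℚ) ≠ 0 := Nat.cast_ne_zero.2 Nat.card_pos.ne'
  have p2 : (Nat.card (GL (Fin (n - s)) F) : ℚ) ≠ 0 := Nat.cast_ne_zero.2 Nat.card_pos.ne'
  have h' := congrArg (Nat.cast : ℕ → ℚ) h
  push_cast at h'
  rw [mul_assoc, div_mul_eq_mul_div, eq_div_iff (mul_ne_zero p1 p2)]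
  exact h'.symm
end

section
/- Let q be a prime power, m = ord(ζ) the multiplicative order of a nonzero ζ ∈ F_q, and S_{ζ,n}(F_q) the set of similarity classes of n×n matrices B over F_q with B similar to ζB. Then |S_{ζ,n}(F_q)| = Σ over finitely-supported sequences (b₁,b₂,…) of nonnegative integers with Σᵢ i·bᵢ = n of Πᵢ q^⌊bᵢ/m⌋. -/
open Polynomial


noncomputable def nulN (F : Type*) [Field F] (N : Type*) [AddCommGroup N] [Module F N] [Module F[X] N]
    [IsScalarTower F F[X] N] (f : F[X]) : ℕ :=
  Module.finrank F (LinearMap.ker (Algebra.lsmul F F N f))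

lemma nulN_congr {F : Type*} [Field F] {N N' : Type*} [AddCommGroup N] [Module F N] [Module F[X] N]
    [IsScalarTower F F[X] N] [AddCommGroup N'] [Module F N'] [Module F[X] N']
    [IsScalarTower F F[X] N'] (e : N ≃ₗ[F[X]] N') (f : F[X]) : nulN F N f = nulN F N' f := by
  refine LinearEquiv.finrank_eq (LinearEquiv.ofSubmodules (e.restrictScalars F) _ _ ?_)
  ext x
  simp only [Submodule.mem_map, LinearMap.mem_ker, Algebra.lsmul_coe]
  constructor
  · rintro ⟨y, hy, rfl⟩
    change f • e y = 0
    rw [← map_smul, hy, map_zero]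
  · intro hx
    refine ⟨e.symm x, ?_, e.apply_symm_apply x⟩
    rw [← map_smul, hx, map_zero]

lemma nulN_pi {F : Type*} [Field F] {ι : Type*} [Fintype ι] (N : ι → Type*)
    [∀ i, AddCommGroup (N i)] [∀ i, Module F (N i)] [∀ i, Module F[X] (N i)]
    [∀ i, IsScalarTower F F[X] (N i)] [∀ i, Module.Finite F (N i)] (f : F[X]) :
    nulN F (∀ i, N i) f = ∑ i, nulN F (N i) f := by
  unfold nulN
  rw [← Module.finrank_pi_fintype]
  refine LinearEquiv.finrank_eq ?_
  exact
  { toFun := fun x i => ⟨x.1 i, by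
      have := x.2
      rw [LinearMap.mem_ker] at this
      exact congrFun this i⟩
    invFun := fun y => ⟨fun i => (y i).1, by
      rw [LinearMap.mem_ker]
      funext i
      exact (y i).2⟩
    map_add' := fun _ _ => rfl
    map_smul' := fun _ _ => rfl
    left_inv := fun _ => rfl
    right_inv := fun _ => rfl }

lemma finite_quot {F : Type*} [Field F] (h : F[X]) (hh : h ≠ 0) :
    Module.Finite F (F[X] ⧸ Ideal.span {h}) :=
  (AdjoinRoot.powerBasis hh).finite

lemma nulN_quot {F : Type*} [Field F] (f h g u v : F[X]) (hh : h ≠ 0) 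
    (hg : g = u * f + v * h) (hgf : g ∣ f) (hgh : g ∣ h) :
    nulN F (F[X] ⧸ Ideal.span {h}) f = g.natDegree := by
  have := finite_quot h hh
  have hg0 : g ≠ 0 := fun h0 => hh (by rw [h0] at hgh; exact zero_dvd_iff.mp hgh)
  have := finite_quot g hg0
  have hle : Ideal.span {h} ≤ Ideal.span {g} := by
    rw [Ideal.span_singleton_le_span_singleton]; exact hgh
  let π : (F[X] ⧸ Ideal.span {h}) →ₗ[F] (F[X] ⧸ Ideal.span {g}) :=
    (Ideal.Quotient.factorₐ F hle).toLinearMap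
  have hπ : ∀ x : F[X], π (Ideal.Quotient.mk _ x) = Ideal.Quotient.mk _ x := fun x => rfl
  have hsurj : LinearMap.range π = ⊤ := by
    rw [LinearMap.range_eq_top]
    intro y
    obtain ⟨x, rfl⟩ := Ideal.Quotient.mk_surjective y
    exact ⟨Ideal.Quotient.mk _ x, rfl⟩
  have hker : LinearMap.ker π = LinearMap.range (Algebra.lsmul F F (F[X] ⧸ Ideal.span {h}) f) := by
    ext y
    obtain ⟨x, rfl⟩ := Ideal.Quotient.mk_surjective y
    rw [LinearMap.mem_ker, hπ, Ideal.Quotient.eq_zero_iff_mem, Ideal.mem_span_singleton,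
      LinearMap.mem_range]
    constructor
    · rintro ⟨c, rfl⟩
      refine ⟨Ideal.Quotient.mk _ (c * u), ?_⟩
      change Ideal.Quotient.mk _ (f * (c * u)) = _
      rw [Ideal.Quotient.eq, Ideal.mem_span_singleton]
      exact ⟨- c * v, by rw [hg]; ring⟩
    · rintro ⟨z, hz⟩
      obtain ⟨z, rfl⟩ := Ideal.Quotient.mk_surjective z
      change Ideal.Quotient.mk _ (f * z) = _ at hz
      rw [Ideal.Quotient.eq, Ideal.mem_span_singleton] at hz
      have h1 := hgh.trans hz
      exact (dvd_sub_right (hgf.mul_right z)).mp h1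
  have e1 := LinearMap.finrank_range_add_finrank_ker π
  have e2 := LinearMap.finrank_range_add_finrank_ker (Algebra.lsmul F F (F[X] ⧸ Ideal.span {h}) f)
  rw [hsurj, finrank_top, hker] at e1
  have e3 : Module.finrank F (F[X] ⧸ Ideal.span {g}) = _ := finrank_quotient_span_eq_natDegree (f := g)
  unfold nulN
  omega

open Classical in
lemma nulN_quot_pow {F : Type*} [Field F] (p q : F[X]) (hp : Irreducible p) (hq : Irreducible q)
    (hpm : p.Monic) (hqm : q.Monic) (j k : ℕ) :
    nulN F (F[X] ⧸ Ideal.span {p ^ k}) (q ^ j) = if p = q then min j k * q.natDegree else 0 := by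
  split_ifs with h
  · subst h
    rw [← natDegree_pow]
    rcases le_total j k with hjk | hjk
    · rw [min_eq_left hjk]
      exact nulN_quot _ _ _ 1 0 (pow_ne_zero _ hp.ne_zero) (by ring) dvd_rfl (pow_dvd_pow _ hjk)
    · rw [min_eq_right hjk]
      exact nulN_quot _ _ _ 0 1 (pow_ne_zero _ hp.ne_zero) (by ring) (pow_dvd_pow _ hjk) dvd_rfl
  · have hc : IsCoprime (q ^ j) (p ^ k) := by
      apply IsCoprime.pow
      rw [hq.coprime_iff_not_dvd]
      intro hd
      exact h (eq_of_monic_of_associated hpm hqm ((hq.associated_of_dvd hp hd).symm))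
    obtain ⟨u, v, huv⟩ := hc
    rw [nulN_quot _ _ 1 u v (pow_ne_zero _ hp.ne_zero) huv.symm (one_dvd _) (one_dvd _), natDegree_one]

abbrev PMod {F : Type*} [Field F] {ι : Type*} (p : ι → F[X]) (κ : ι → ℕ) : Type _ :=
  ∀ i, F[X] ⧸ Ideal.span {p i ^ (κ i + 1)}

open Classical in
lemma nulN_PMod {F : Type*} [Field F] {ι : Type*} [Fintype ι] (p : ι → F[X]) (κ : ι → ℕ)
    (hp : ∀ i, Irreducible (p i)) (hpm : ∀ i, (p i).Monic) (q : F[X]) (hq : Irreducible q)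
    (hqm : q.Monic) (k : ℕ) :
    (Finset.univ.filter fun i => p i = q ∧ κ i = k).card * q.natDegree + nulN F (PMod p κ) (q ^ k)
      + nulN F (PMod p κ) (q ^ (k + 2)) = 2 * nulN F (PMod p κ) (q ^ (k + 1)) := by
  have : ∀ i, Module.Finite F (F[X] ⧸ Ideal.span {p i ^ (κ i + 1)}) := fun i =>
    finite_quot _ (pow_ne_zero _ (hp i).ne_zero)
  rw [nulN_pi, nulN_pi, nulN_pi, Finset.card_filter, Finset.sum_mul, ← Finset.sum_add_distrib,
    ← Finset.sum_add_distrib, Finset.mul_sum]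
  refine Finset.sum_congr rfl fun i _ => ?_
  simp only [nulN_quot_pow _ _ (hp i) hq (hpm i) hqm]
  by_cases h : p i = q
  · simp only [h, if_true, true_and]
    rw [← add_mul, ← add_mul, ← mul_assoc]
    congr 1
    split_ifs <;> omega
  · simp [h]

lemma finrank_PMod {F : Type*} [Field F] {ι : Type*} [Fintype ι] (p : ι → F[X]) (κ : ι → ℕ)
    (hp : ∀ i, Irreducible (p i)) :
    Module.finrank F (PMod p κ) = ∑ i, (κ i + 1) * (p i).natDegree := by
  have : ∀ i, Module.Finite F (F[X] ⧸ Ideal.span {p i ^ (κ i + 1)}) := fun i =>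
    finite_quot _ (pow_ne_zero _ (hp i).ne_zero)
  rw [Module.finrank_pi_fintype]
  refine Finset.sum_congr rfl fun i _ => ?_
  rw [← natDegree_pow]
  exact finrank_quotient_span_eq_natDegree


def Sim {F : Type*} [Field F] {n : ℕ} (B C : Matrix (Fin n) (Fin n) F) : Prop :=
  ∃ P : GL (Fin n) F, (P : Matrix (Fin n) (Fin n) F) * B *
          ((P⁻¹ : GL (Fin n) F) : Matrix (Fin n) (Fin n) F) = C

abbrev BMod {F : Type*} [Field F] {n : ℕ} (B : Matrix (Fin n) (Fin n) F) : Type _ :=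
  Module.AEval' (Matrix.toLin' B)

noncomputable def nul {F : Type*} [Field F] {n : ℕ} (B : Matrix (Fin n) (Fin n) F) (f : F[X]) : ℕ :=
  nulN F (BMod B) f

lemma Sim.refl {F : Type*} [Field F] {n : ℕ} (B : Matrix (Fin n) (Fin n) F) : Sim B B := ⟨1, by simp⟩

lemma Sim.trans {F : Type*} [Field F] {n : ℕ} {B C D : Matrix (Fin n) (Fin n) F} (h : Sim B C)
    (h' : Sim C D) : Sim B D := by
  obtain ⟨P, rfl⟩ := h
  obtain ⟨Q, rfl⟩ := h'
  exact ⟨Q * P, by simp [mul_assoc]⟩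

lemma Sim.symm {F : Type*} [Field F] {n : ℕ} {B C : Matrix (Fin n) (Fin n) F} (h : Sim B C) :
    Sim C B := by
  obtain ⟨P, rfl⟩ := h
  exact ⟨P⁻¹, by simp [mul_assoc]⟩

lemma sim_iff_equiv {F : Type*} [Field F] {n : ℕ} {B C : Matrix (Fin n) (Fin n) F} :
    Sim B C ↔ Nonempty (BMod B ≃ₗ[F[X]] BMod C) := by
  constructor
  · rintro ⟨P, h⟩
    have h' : (P : Matrix (Fin n) (Fin n) F) * B = C * P := by
      rw [← h]; simp [mul_assoc]
    let e : (Fin n → F) ≃ₗ[F] (Fin n → F) := LinearEquiv.ofLinearMap (Matrix.toLin' P.1)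
      (Matrix.toLin' (P⁻¹).1) (by rw [← Matrix.toLin'_mul]; simp) (by rw [← Matrix.toLin'_mul]; simp)
    refine ⟨LinearEquiv.ofAEval (Matrix.toLin' B) (e.trans (Module.AEval'.of (Matrix.toLin' C))) ?_⟩
    intro v
    rw [LinearEquiv.trans_apply, LinearEquiv.trans_apply, Module.AEval'.X_smul_of]
    congr 1
    change Matrix.toLin' P.1 (Matrix.toLin' B v) = Matrix.toLin' C (Matrix.toLin' P.1 v)
    rw [← Matrix.toLin'_mul_apply, ← Matrix.toLin'_mul_apply, h']
  · rintro ⟨e⟩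
    let e' : (Fin n → F) ≃ₗ[F] (Fin n → F) := (Module.AEval'.of (Matrix.toLin' B)).trans
      ((e.restrictScalars F).trans (Module.AEval'.of (Matrix.toLin' C)).symm)
    have he : ∀ v, e' (Matrix.toLin' B v) = Matrix.toLin' C (e' v) := by
      intro v
      change (Module.AEval'.of (Matrix.toLin' C)).symm (e (Module.AEval'.of (Matrix.toLin' B) _)) = _
      rw [← Module.AEval'.X_smul_of, map_smul, Module.AEval'.of_symm_X_smul]
      rfl
    let P : GL (Fin n) F := ⟨LinearMap.toMatrix' e'.toLinearMap, LinearMap.toMatrix' e'.symm.toLinearMap,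
      by rw [← LinearMap.toMatrix'_comp]; simp, by rw [← LinearMap.toMatrix'_comp]; simp⟩
    have h' : (P : Matrix (Fin n) (Fin n) F) * B = C * P := by
      apply Matrix.toLin'.injective
      refine LinearMap.ext fun v => ?_
      rw [Matrix.toLin'_mul_apply, Matrix.toLin'_mul_apply]
      simpa [P] using he v
    refine ⟨P, ?_⟩
    rw [h', mul_assoc, ← Units.val_mul, mul_inv_cancel, Units.val_one, mul_one]

lemma PMod_equiv {F : Type*} [Field F] {ι ι' : Type*} [Fintype ι] [Fintype ι'] (p : ι → F[X])
    (κ : ι → ℕ) (p' : ι' → F[X]) (κ' : ι' → ℕ)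
    (h : ∀ q k, Nat.card {i // p i = q ∧ κ i = k} = Nat.card {i // p' i = q ∧ κ' i = k}) :
    Nonempty (PMod p κ ≃ₗ[F[X]] PMod p' κ') := by
  have h2 : ∀ c : F[X] × ℕ, Nonempty ({i // (p i, κ i) = c} ≃ {i // (p' i, κ' i) = c}) := by
    rintro ⟨q, k⟩
    simp only [Prod.mk.injEq]
    exact (Finite.card_eq.mp (h q k))
  let σ : ι ≃ ι' := Equiv.ofFiberEquiv (fun c => (h2 c).some)
  have hσ : ∀ i, (p' (σ i), κ' (σ i)) = (p i, κ i) := fun i =>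
    Equiv.ofFiberEquiv_map (f := fun i => (p i, κ i)) (g := fun i => (p' i, κ' i))
      (fun c => (h2 c).some) i
  have h1 : ∀ i, p' (σ i) = p i := fun i => (Prod.mk.inj (hσ i)).1
  have h3 : ∀ i, κ' (σ i) = κ i := fun i => (Prod.mk.inj (hσ i)).2
  refine ⟨(LinearEquiv.piCongrRight fun i => Submodule.quotEquivOfEq _ _ ?_).trans
    (LinearEquiv.piCongrLeft F[X] (fun i => F[X] ⧸ Ideal.span {p' i ^ (κ' i + 1)}) σ)⟩
  rw [h1, h3]

lemma exists_decomp.{u} {F : Type u} [Field F] {n : ℕ} (B : Matrix (Fin n) (Fin n) F) :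
    ∃ (ι : Type u) (_ : Fintype ι) (p : ι → F[X]) (κ : ι → ℕ), (∀ i, Irreducible (p i)) ∧
      (∀ i, (p i).Monic) ∧ Nonempty (BMod B ≃ₗ[F[X]] PMod p κ) := by
  classical
  obtain ⟨ι, _, p, hp, e, ⟨φ⟩⟩ := Module.equiv_directSum_of_isTorsion
    (Module.AEval.isTorsion_of_finiteDimensional F (Fin n → F) (Matrix.toLin' B))
  refine ⟨{i // e i ≠ 0}, inferInstance, fun i => normalize (p i), fun i => e i - 1, ?_, ?_, ?_⟩
  · intro i
    exact (normalize_associated (p i)).symm.irreducible (hp i)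
  · intro i
    exact monic_normalize (hp i).ne_zero
  · have hs : ∀ i : {i // e i ≠ 0}, Ideal.span {p i ^ e i} =
        Ideal.span {normalize (p i.1) ^ (e i.1 - 1 + 1)} := by
      intro i
      rw [Nat.sub_add_cancel (Nat.pos_of_ne_zero i.2), Ideal.span_singleton_eq_span_singleton]
      exact (normalize_associated (p i)).symm.pow_pow
    let ψ : (∀ i, F[X] ⧸ Ideal.span {p i ^ e i}) →ₗ[F[X]]
      (∀ i : {i // e i ≠ 0}, F[X] ⧸ Ideal.span {p i ^ e i}) :=
      LinearMap.pi fun i => LinearMap.proj i.1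
    have hψ : Function.Bijective ψ := by
      constructor
      · rw [← LinearMap.ker_eq_bot, LinearMap.ker_eq_bot']
        intro v hv
        funext i
        by_cases hi : e i = 0
        · have : Subsingleton (F[X] ⧸ Ideal.span {p i ^ e i}) := by
            rw [hi, pow_zero, Ideal.span_singleton_one]
            infer_instance
          exact Subsingleton.elim _ _
        · exact congrFun hv ⟨i, hi⟩
      · intro w
        refine ⟨fun i => if hi : e i ≠ 0 then w ⟨i, hi⟩ else 0, ?_⟩
        funext i
        change (if hi : e i.1 ≠ 0 then w ⟨i.1, hi⟩ else 0) = w i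
        rw [dif_pos i.2]
    exact ⟨φ.trans ((DirectSum.linearEquivFunOnFintype F[X] ι _).trans
      ((LinearEquiv.ofBijective ψ hψ).trans
        (LinearEquiv.piCongrRight fun i => Submodule.quotEquivOfEq _ _ (hs i))))⟩

lemma exists_matrix {F : Type*} [Field F] {n : ℕ} {ι : Type*} [Fintype ι] (p : ι → F[X])
    (κ : ι → ℕ) (hp : ∀ i, Irreducible (p i)) (hn : ∑ i, (κ i + 1) * (p i).natDegree = n) :
    ∃ B : Matrix (Fin n) (Fin n) F, Nonempty (BMod B ≃ₗ[F[X]] PMod p κ) := by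
  have : ∀ i, Module.Finite F (F[X] ⧸ Ideal.span {p i ^ (κ i + 1)}) := fun i =>
    finite_quot _ (pow_ne_zero _ (hp i).ne_zero)
  have e : (Fin n → F) ≃ₗ[F] PMod p κ := LinearEquiv.ofFinrankEq _ _ (by
    rw [finrank_PMod p κ hp, hn]; simp)
  let φ : (Fin n → F) →ₗ[F] (Fin n → F) :=
    e.symm.toLinearMap ∘ₗ (Algebra.lsmul F F (PMod p κ) (X : F[X])) ∘ₗ e.toLinearMap
  refine ⟨LinearMap.toMatrix' φ, ⟨LinearEquiv.ofAEval _ e ?_⟩⟩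
  intro v
  rw [Matrix.toLin'_toMatrix']
  change e (e.symm ((X : F[X]) • e v)) = _
  rw [LinearEquiv.apply_symm_apply]

lemma nul_C_mul {F : Type*} [Field F] {n : ℕ} (B : Matrix (Fin n) (Fin n) F) (c : F) (hc : c ≠ 0)
    (f : F[X]) : nul B (C c * f) = nul B f := by
  unfold nul nulN
  rw [← smul_eq_C_mul, map_smul, LinearMap.ker_smul _ _ hc]

lemma nul_smul {F : Type*} [Field F] {n : ℕ} (B : Matrix (Fin n) (Fin n) F) (c : F)
    (f : F[X]) : nul (c • B) f = nul B (f.comp (C c * X)) := by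
  have : aeval (Matrix.toLin' (c • B)) f = aeval (Matrix.toLin' B) (f.comp (C c * X)) := by
    rw [aeval_comp]
    simp [Algebra.algebraMap_eq_smul_one]
  change Module.finrank F (LinearMap.ker (aeval (Matrix.toLin' (c • B)) f)) =
    Module.finrank F (LinearMap.ker (aeval (Matrix.toLin' B) (f.comp (C c * X))))
  rw [this]

lemma scaleRoots_inv_eq {F : Type*} [Field F] (c : F) (hc : c ≠ 0) (q : F[X]) :
    q.scaleRoots c⁻¹ = C (c⁻¹ ^ q.natDegree) * q.comp (C c * X) := by
  ext i
  rw [coeff_scaleRoots, coeff_C_mul, comp_C_mul_X_coeff]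
  by_cases hi : i ≤ q.natDegree
  · obtain ⟨d, hd⟩ := Nat.exists_eq_add_of_le hi
    rw [hd, Nat.add_sub_cancel_left, pow_add]
    have : c⁻¹ ^ i * c ^ i = 1 := by rw [← mul_pow, inv_mul_cancel₀ hc, one_pow]
    linear_combination (- q.coeff i * c⁻¹ ^ d) * this
  · rw [coeff_eq_zero_of_natDegree_lt (by omega)]; simp

lemma nul_smul_pow {F : Type*} [Field F] {n : ℕ} (B : Matrix (Fin n) (Fin n) F) (c : F) (hc : c ≠ 0)
    (q : F[X]) (j : ℕ) : nul (c • B) (q ^ j) = nul B ((q.scaleRoots c⁻¹) ^ j) := by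
  rw [nul_smul B c, scaleRoots_inv_eq c hc, mul_pow, ← C_pow, nul_C_mul, pow_comp]
  exact pow_ne_zero _ (pow_ne_zero _ (inv_ne_zero hc))

/-- relation between a matrix and its sequence of monic polynomials -/
def GRel {F : Type*} [Field F] {n : ℕ} (B : Matrix (Fin n) (Fin n) F) (g : ℕ → F[X]) : Prop :=
  ∀ q : F[X], Irreducible q → q.Monic → ∀ k, multiplicity q (g k) * q.natDegree + nul B (q ^ k)
    + nul B (q ^ (k + 2)) = 2 * nul B (q ^ (k + 1))

lemma GRel.of_sim {F : Type*} [Field F] {n : ℕ} {B C : Matrix (Fin n) (Fin n) F} {g : ℕ → F[X]}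
    (h : GRel B g) (hs : Sim B C) : GRel C g := by
  obtain ⟨e⟩ := sim_iff_equiv.mp hs
  have : nul B = nul C := funext fun f => nulN_congr e f
  unfold GRel
  rw [← this]
  exact h

lemma multiplicity_scaleRoots {F : Type*} [Field F] (c : F) (hc : c ≠ 0) (q g : F[X]) :
    multiplicity q (g.scaleRoots c) = multiplicity (q.scaleRoots c⁻¹) g := by
  have key : ∀ a, q ^ a ∣ g.scaleRoots c ↔ (q.scaleRoots c⁻¹) ^ a ∣ g := by
    intro a
    rw [← pow_scaleRoots_of_isReduced, ← scaleRoots_dvd_iff (q ^ a) _ (r := c⁻¹) (by simpa using hc),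
      ← scaleRoots_mul, mul_inv_cancel₀ hc, scaleRoots_one]
  have : emultiplicity q (g.scaleRoots c) = emultiplicity (q.scaleRoots c⁻¹) g := by
    apply le_antisymm <;> rw [emultiplicity_le_emultiplicity_iff]
    · intro a h; exact (key a).1 h
    · intro a h; exact (key a).2 h
  unfold multiplicity
  rw [this]

lemma irreducible_scaleRoots {F : Type*} [Field F] (c : F) (hc : c ≠ 0) (q : F[X])
    (hq : Irreducible q) : Irreducible (q.scaleRoots c⁻¹) := by
  have e : q.scaleRoots c⁻¹ = C (c⁻¹ ^ q.natDegree) * q.comp (C c * X) := scaleRoots_inv_eq c hc q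
  let := invertibleOfNonzero hc
  have e2 : q.comp (C c * X) = algEquivCMulXAddC c 0 q := by
    rw [algEquivCMulXAddC_apply, comp_eq_aeval]; simp
  have hu : IsUnit (C (c⁻¹ ^ q.natDegree)) := isUnit_C.2 (by simp [hc])
  rw [e, e2, irreducible_isUnit_mul hu]
  exact (MulEquiv.irreducible_iff (algEquivCMulXAddC c 0)).2 hq

lemma GRel.smul {F : Type*} [Field F] {n : ℕ} {B : Matrix (Fin n) (Fin n) F} {g : ℕ → F[X]}
    (h : GRel B g) (c : F) (hc : c ≠ 0) : GRel (c • B) (fun k => (g k).scaleRoots c) := by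
  intro q hq hqm k
  rw [nul_smul_pow _ _ hc, nul_smul_pow _ _ hc, nul_smul_pow _ _ hc, multiplicity_scaleRoots c hc,
    ← natDegree_scaleRoots q c⁻¹]
  exact h _ (irreducible_scaleRoots c hc q hq) ((monic_scaleRoots_iff _).2 hqm) k


open Classical in
lemma multiplicity_prod_card {F : Type*} [Field F] {ι : Type*} [Fintype ι] (p : ι → F[X])
    (κ : ι → ℕ) (hp : ∀ i, Irreducible (p i)) (hpm : ∀ i, (p i).Monic) (q : F[X])
    (hq : Irreducible q) (hqm : q.Monic) (k : ℕ) :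
    multiplicity q (∏ i with κ i = k, p i) =
      (Finset.univ.filter fun i => p i = q ∧ κ i = k).card := by
  have h1 : ∀ i, emultiplicity q (p i) = if p i = q then (1 : ℕ∞) else 0 := by
    intro i
    split_ifs with h
    · rw [h]
      have := (FiniteMultiplicity.of_prime_left hq.prime hq.ne_zero).emultiplicity_self
      exact this
    · rw [emultiplicity_eq_zero]
      intro hd
      exact h (eq_of_monic_of_associated (hpm i) hqm ((hq.associated_of_dvd (hp i) hd).symm))
  apply multiplicity_eq_of_emultiplicity_eq_some
  rw [Finset.emultiplicity_prod hq.prime]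
  simp only [h1]
  rw [Finset.sum_ite, Finset.filter_filter]
  simp [and_comm]

lemma GRel.of_decomp {F : Type*} [Field F] {n : ℕ} {B : Matrix (Fin n) (Fin n) F} {ι : Type*}
    [Fintype ι] (p : ι → F[X]) (κ : ι → ℕ) (hp : ∀ i, Irreducible (p i)) (hpm : ∀ i, (p i).Monic)
    (e : BMod B ≃ₗ[F[X]] PMod p κ) : GRel B (fun k => ∏ i with κ i = k, p i) := by
  intro q hq hqm k
  unfold nul
  simp only [nulN_congr e]
  rw [multiplicity_prod_card p κ hp hpm q hq hqm]
  exact nulN_PMod p κ hp hpm q hq hqm k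

lemma sim_of_nul {F : Type*} [Field F] {n : ℕ} {B C : Matrix (Fin n) (Fin n) F} (g : ℕ → F[X])
    (hB : GRel B g) (hC : GRel C g) : Sim B C := by
  classical
  obtain ⟨ι, _, p, κ, hp, hpm, ⟨e⟩⟩ := exists_decomp B
  obtain ⟨ι', _, p', κ', hp', hpm', ⟨e'⟩⟩ := exists_decomp C
  have r := GRel.of_decomp p κ hp hpm e
  have r' := GRel.of_decomp p' κ' hp' hpm' e'
  have : Nonempty (PMod p κ ≃ₗ[F[X]] PMod p' κ') := by
    apply PMod_equiv
    intro q k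
    by_cases hq : Irreducible q ∧ q.Monic
    · have hd := hq.1.natDegree_pos
      have a1 := r q hq.1 hq.2 k
      have a2 := r' q hq.1 hq.2 k
      have a3 := hB q hq.1 hq.2 k
      have a4 := hC q hq.1 hq.2 k
      rw [multiplicity_prod_card p κ hp hpm q hq.1 hq.2] at a1
      rw [multiplicity_prod_card p' κ' hp' hpm' q hq.1 hq.2] at a2
      rw [Nat.card_eq_fintype_card, Nat.card_eq_fintype_card, Fintype.card_subtype,
        Fintype.card_subtype]
      apply Nat.eq_of_mul_eq_mul_right hd
      omega
    · have h1 : IsEmpty {i // p i = q ∧ κ i = k} :=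
        ⟨fun i => hq ⟨i.2.1 ▸ hp i.1, i.2.1 ▸ hpm i.1⟩⟩
      have h2 : IsEmpty {i // p' i = q ∧ κ' i = k} :=
        ⟨fun i => hq ⟨i.2.1 ▸ hp' i.1, i.2.1 ▸ hpm' i.1⟩⟩
      rw [Nat.card_of_isEmpty, Nat.card_of_isEmpty]
  obtain ⟨φ⟩ := this
  exact sim_iff_equiv.2 ⟨e.trans (φ.trans e'.symm)⟩

lemma eq_of_multiplicity {F : Type*} [Field F] (g g' : F[X]) (hg : g.Monic) (hg' : g'.Monic)
    (h : ∀ q : F[X], Irreducible q → q.Monic → multiplicity q g = multiplicity q g') : g = g' := by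
  classical
  apply eq_of_monic_of_associated hg hg'
  rw [UniqueFactorizationMonoid.associated_iff_normalizedFactors_eq_normalizedFactors hg.ne_zero
    hg'.ne_zero]
  ext q
  by_cases hq : Irreducible q ∧ q.Monic
  · have e1 := UniqueFactorizationMonoid.emultiplicity_eq_count_normalizedFactors hq.1 hg.ne_zero
    have e2 := UniqueFactorizationMonoid.emultiplicity_eq_count_normalizedFactors hq.1 hg'.ne_zero
    rw [hq.2.normalize_eq_self] at e1 e2
    rw [← multiplicity_eq_of_emultiplicity_eq_some e1, ← multiplicity_eq_of_emultiplicity_eq_some e2]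
    exact h q hq.1 hq.2
  · have key : ∀ f : F[X], q ∉ UniqueFactorizationMonoid.normalizedFactors f := by
      intro f hf
      apply hq
      refine ⟨UniqueFactorizationMonoid.irreducible_of_normalized_factor q hf, ?_⟩
      rw [← UniqueFactorizationMonoid.normalize_normalized_factor q hf]
      exact monic_normalize (UniqueFactorizationMonoid.irreducible_of_normalized_factor q hf).ne_zero
    rw [Multiset.count_eq_zero_of_notMem (key _), Multiset.count_eq_zero_of_notMem (key _)]

lemma GRel.unique {F : Type*} [Field F] {n : ℕ} {B : Matrix (Fin n) (Fin n) F} {g g' : ℕ → F[X]}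
    (h : GRel B g) (h' : GRel B g') (hg : ∀ k, (g k).Monic) (hg' : ∀ k, (g' k).Monic) : g = g' := by
  funext k
  apply eq_of_multiplicity _ _ (hg k) (hg' k)
  intro q hq hqm
  have a1 := h q hq hqm k
  have a2 := h' q hq hqm k
  apply Nat.eq_of_mul_eq_mul_right hq.natDegree_pos
  omega

/-- sequences of monic polynomials of total weighted degree `n` -/
def Good {F : Type*} [Field F] (n : ℕ) (g : ℕ → F[X]) : Prop :=
  (∀ k, (g k).Monic) ∧ ∃ b : ℕ →₀ ℕ, (∀ k, (g k).natDegree = b k) ∧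
    ∑ i ∈ b.support, (i + 1) * b i = n

lemma sum_weight {F : Type*} [Field F] {ι : Type*} [Fintype ι] (p : ι → F[X])
    (κ : ι → ℕ) (hpm : ∀ i, (p i).Monic) (b : ℕ →₀ ℕ)
    (hb : ∀ k, (∏ i with κ i = k, p i).natDegree = b k) :
    ∑ i ∈ b.support, (i + 1) * b i = ∑ i, (κ i + 1) * (p i).natDegree := by
  classical
  have e : b = ∑ i, Finsupp.single (κ i) (p i).natDegree := by
    ext k
    rw [← hb, natDegree_prod_of_monic _ _ (fun i _ => hpm i), Finsupp.finsetSum_apply,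
      Finset.sum_filter]
    refine Finset.sum_congr rfl fun i _ => ?_
    rw [Finsupp.single_apply]
  change b.sum (fun i x => (i + 1) * x) = _
  rw [e, ← Finsupp.sum_finsetSum_index (by simp) (by intros; ring)]
  refine Finset.sum_congr rfl fun i _ => ?_
  rw [Finsupp.sum_single_index (by simp)]

lemma exists_good {F : Type*} [Field F] {n : ℕ} (B : Matrix (Fin n) (Fin n) F) :
    ∃ g : ℕ → F[X], Good n g ∧ GRel B g := by
  classical
  obtain ⟨ι, _, p, κ, hp, hpm, ⟨e⟩⟩ := exists_decomp B
  refine ⟨_, ⟨fun k => monic_prod_of_monic _ _ fun i _ => hpm i, ?_⟩, GRel.of_decomp p κ hp hpm e⟩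
  let b : ℕ →₀ ℕ := ∑ i, Finsupp.single (κ i) (p i).natDegree
  have hb : ∀ k, (∏ i with κ i = k, p i).natDegree = b k := by
    intro k
    rw [natDegree_prod_of_monic _ _ (fun i _ => hpm i), Finsupp.finsetSum_apply,
      Finset.sum_filter]
    refine Finset.sum_congr rfl fun i _ => ?_
    rw [Finsupp.single_apply]
  refine ⟨b, hb, ?_⟩
  rw [sum_weight p κ hpm b hb, ← finrank_PMod p κ hp, ← (e.restrictScalars F).finrank_eq,
    ← (Module.AEval'.of (Matrix.toLin' B)).finrank_eq]
  simp

lemma exists_of_good {F : Type*} [Field F] {n : ℕ} (g : ℕ → F[X]) (hg : Good n g) :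
    ∃ B : Matrix (Fin n) (Fin n) F, GRel B g := by
  classical
  obtain ⟨hm, b, hb, hn⟩ := hg
  let L : ℕ → List F[X] := fun k => (UniqueFactorizationMonoid.normalizedFactors (g k)).toList
  have hL : ∀ k x, x ∈ L k → x ∈ UniqueFactorizationMonoid.normalizedFactors (g k) := fun k x hx =>
    Multiset.mem_toList.1 hx
  have hprod : ∀ k, (L k).prod = g k := by
    intro k
    rw [Multiset.prod_toList, UniqueFactorizationMonoid.prod_normalizedFactors_eq (hm k).ne_zero,
      (hm k).normalize_eq_self]
  let ι := Σ k : b.support, Fin (L k.1).length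
  let p : ι → F[X] := fun i => (L i.1.1).get i.2
  let κ : ι → ℕ := fun i => i.1.1
  have hp : ∀ i, Irreducible (p i) := fun i =>
    UniqueFactorizationMonoid.irreducible_of_normalized_factor _ (hL _ _ (List.get_mem _ _))
  have hpm : ∀ i, (p i).Monic := fun i => by
    rw [← UniqueFactorizationMonoid.normalize_normalized_factor _ (hL i.1.1 (p i) (List.get_mem _ _))]
    exact monic_normalize (hp i).ne_zero
  have hgp : ∀ k, ∏ i with κ i = k, p i = g k := by
    intro k
    rw [Finset.prod_filter, Fintype.prod_sigma]
    have : ∀ x : b.support, (∏ y : Fin (L x.1).length, if κ ⟨x, y⟩ = k then p ⟨x, y⟩ else 1) =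
        if x.1 = k then g k else 1 := by
      intro x
      change (∏ y : Fin (L x.1).length, if x.1 = k then (L x.1).get y else 1) = _
      split_ifs with h
      · rw [← hprod k, ← h, ← List.prod_ofFn, List.ofFn_get]
      · simp
    simp only [this]
    rw [Finset.prod_coe_sort b.support (fun x => if x = k then g k else 1), Finset.prod_ite_eq']
    split_ifs with h
    · rfl
    · have h0 : (g k).natDegree = 0 := by rw [hb]; simpa using h
      exact ((hm k).natDegree_eq_zero.1 h0).symm
  have hsum := sum_weight p κ hpm b (fun k => by rw [hgp, hb])
  obtain ⟨B, ⟨e⟩⟩ := exists_matrix p κ hp (hsum.symm.trans hn)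
  refine ⟨B, ?_⟩
  have := GRel.of_decomp p κ hp hpm e
  rwa [funext hgp] at this

lemma sim_smul_iff {F : Type*} [Field F] {n : ℕ} {B : Matrix (Fin n) (Fin n) F} {g : ℕ → F[X]}
    (hg : ∀ k, (g k).Monic) (h : GRel B g) (c : F) (hc : c ≠ 0) :
    Sim B (c • B) ↔ ∀ k, (g k).scaleRoots c = g k := by
  constructor
  · intro hs k
    exact congrFun ((h.smul c hc).unique (h.of_sim hs) (fun k => (monic_scaleRoots_iff _).2 (hg k)) hg) k
  · intro hk
    have := h.smul c hc
    rw [funext hk] at this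
    exact sim_of_nul _ h this

lemma card_classes {F : Type*} [Field F] (c : F) (hc : c ≠ 0) (n : ℕ) :
    Nat.card {O : Set (Matrix (Fin n) (Fin n) F) // ∃ B : Matrix (Fin n) (Fin n) F,
        (∃ P : GL (Fin n) F, (P : Matrix (Fin n) (Fin n) F) * B *
          ((P⁻¹ : GL (Fin n) F) : Matrix (Fin n) (Fin n) F) = c • B) ∧
        O = {C | ∃ P : GL (Fin n) F, C = (P : Matrix (Fin n) (Fin n) F) * B *
          ((P⁻¹ : GL (Fin n) F) : Matrix (Fin n) (Fin n) F)}} =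
    Nat.card {g : ℕ → F[X] // Good n g ∧ ∀ k, (g k).scaleRoots c = g k} := by
  symm
  have horb : ∀ B C : Matrix (Fin n) (Fin n) F, C ∈ {C | ∃ P : GL (Fin n) F,
      C = (P : Matrix (Fin n) (Fin n) F) * B *
          ((P⁻¹ : GL (Fin n) F) : Matrix (Fin n) (Fin n) F)} ↔ Sim B C := fun B C =>
    ⟨fun ⟨P, hP⟩ => ⟨P, hP.symm⟩, fun ⟨P, hP⟩ => ⟨P, hP.symm⟩⟩
  choose M hM using fun g : {g : ℕ → F[X] // Good n g ∧ ∀ k, (g k).scaleRoots c = g k} =>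
    exists_of_good g.1 g.2.1
  refine Nat.card_congr (Equiv.ofBijective (fun g => ⟨_, M g,
    (sim_smul_iff g.2.1.1 (hM g) c hc).2 g.2.2, rfl⟩) ⟨?_, ?_⟩)
  · intro g g' h
    have h1 := Subtype.ext_iff.1 h
    have h2 : Sim (M g) (M g') := by
      rw [← horb]
      have h3 := (horb (M g') (M g')).2 (Sim.refl _)
      exact (Set.ext_iff.1 h1 (M g')).2 h3
    exact Subtype.ext (((hM g).of_sim h2).unique (hM g') g.2.1.1 g'.2.1.1)
  · rintro ⟨O, B, hB, rfl⟩
    obtain ⟨g, hg, hr⟩ := exists_good B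
    refine ⟨⟨g, hg, (sim_smul_iff hg.1 hr c hc).1 hB⟩, ?_⟩
    apply Subtype.ext
    have hs := sim_of_nul g hr (hM ⟨g, hg, (sim_smul_iff hg.1 hr c hc).1 hB⟩)
    ext C
    rw [horb, horb]
    exact ⟨fun h => hs.trans h, fun h => hs.symm.trans h⟩


lemma card_fixed {F : Type*} [Field F] [Fintype F] (ζ : Fˣ) (m : ℕ) (hm : m = orderOf ζ) (b : ℕ) :
    Nat.card {g : F[X] // g.Monic ∧ g.natDegree = b ∧ g.scaleRoots (ζ : F) = g} =
      Fintype.card F ^ (b / m) := by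
  have hm0 : 0 < m := hm ▸ orderOf_pos ζ
  have hpow : ∀ a, (ζ : F) ^ a = 1 ↔ m ∣ a := by
    intro a
    rw [hm, orderOf_dvd_iff_pow_eq_one, ← Units.val_pow_eq_pow_val, Units.val_eq_one]
  have : Nat.card (Fin (b / m) → F) = Fintype.card F ^ (b / m) := by simp
  rw [← this]
  have hlt : ∀ i : Fin (b / m), m * (i.1 + 1) ≤ b := fun i =>
    (Nat.mul_le_mul_left m i.2).trans (Nat.mul_div_le b m)
  refine Nat.card_congr (Equiv.ofBijective (fun g i => g.1.coeff (b - m * (i.1 + 1))) ⟨?_, ?_⟩)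
  · rintro ⟨g, hg, hgb, hgs⟩ ⟨g', hg', hgb', hgs'⟩ h
    apply Subtype.ext
    change g = g'
    ext j
    have key : ∀ f : F[X], f.natDegree = b → f.scaleRoots (ζ : F) = f → ¬ m ∣ b - j →
        f.coeff j = 0 := by
      intro f hfb hfs hj
      have := congrArg (fun x => x.coeff j) hfs
      simp only [coeff_scaleRoots, hfb] at this
      by_contra h0
      exact hj ((hpow _).1 (mul_left_cancel₀ h0 (by rw [this, mul_one])))
    rcases lt_trichotomy j b with hj | hj | hj
    · by_cases hd : m ∣ b - j
      · obtain ⟨t, ht⟩ := hd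
        have ht0 : t ≠ 0 := by rintro rfl; omega
        have htb : t - 1 < b / m := by
          have : t ≤ b / m := by
            rw [Nat.le_div_iff_mul_le hm0, mul_comm]; omega
          omega
        have h1 := congrFun h ⟨t - 1, htb⟩
        simp only [Nat.sub_add_cancel (Nat.pos_of_ne_zero ht0)] at h1
        rwa [← ht, Nat.sub_sub_self hj.le] at h1
      · rw [key g hgb hgs hd, key g' hgb' hgs' hd]
    · subst hj
      rw [← hgb, hg.coeff_natDegree, hgb, ← hgb', hg'.coeff_natDegree]
    · rw [coeff_eq_zero_of_natDegree_lt (by omega), coeff_eq_zero_of_natDegree_lt (by omega)]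
  · intro c
    let a : ℕ → F := fun j => if h : m ∣ b - j ∧ (b - j) / m - 1 < b / m then
      c ⟨(b - j) / m - 1, h.2⟩ else 0
    let r : F[X] := ∑ j ∈ Finset.range b, monomial j (a j)
    have hr : r.degree < b := by
      rw [degree_lt_iff_coeff_zero]
      intro j hj
      simp only [r, finsetSum_coeff, coeff_monomial]
      rw [Finset.sum_ite_eq', if_neg (by simpa using hj)]
    have hrc : ∀ j < b, r.coeff j = a j := by
      intro j hj
      simp only [r, finsetSum_coeff, coeff_monomial]
      rw [Finset.sum_ite_eq', if_pos (by simpa using hj)]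
    have hd : (X ^ b + r).natDegree = b := by
      apply natDegree_eq_of_degree_eq_some
      rw [degree_add_eq_left_of_degree_lt (by rwa [degree_X_pow]), degree_X_pow]
    refine ⟨⟨X ^ b + r, monic_X_pow_add hr, hd, ?_⟩, ?_⟩
    · ext j
      rw [coeff_scaleRoots, hd]
      rcases lt_trichotomy j b with hj | hj | hj
      · rw [coeff_add, coeff_X_pow, if_neg hj.ne, zero_add, hrc j hj]
        by_cases hdv : m ∣ b - j
        · rw [(hpow _).2 hdv, mul_one]
        · have : a j = 0 := dif_neg fun h => hdv h.1
          rw [this, zero_mul]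
      · subst hj; simp
      · rw [coeff_eq_zero_of_natDegree_lt (by omega), zero_mul]
    · funext i
      have hi := hlt i
      have hpos : 0 < m * (i.1 + 1) := by positivity
      have hj : b - m * (i.1 + 1) < b := by omega
      change (X ^ b + r).coeff _ = _
      rw [coeff_add, coeff_X_pow, if_neg hj.ne, zero_add, hrc _ hj]
      have e : (b - (b - m * (i.1 + 1))) / m - 1 = i.1 := by
        rw [Nat.sub_sub_self hi, Nat.mul_div_cancel_left _ hm0]; omega
      have hc : m ∣ b - (b - m * (i.1 + 1)) ∧ (b - (b - m * (i.1 + 1))) / m - 1 < b / m := by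
        refine ⟨?_, by rw [e]; exact i.2⟩
        rw [Nat.sub_sub_self hi]; exact dvd_mul_right _ _
      refine (dif_pos hc).trans ?_
      congr 1
      exact Fin.ext e

lemma finite_weights (n : ℕ) : {b : ℕ →₀ ℕ | ∑ i ∈ b.support, (i + 1) * b i = n}.Finite := by
  classical
  have hle : ∀ b : ℕ →₀ ℕ, ∑ i ∈ b.support, (i + 1) * b i = n → ∀ i, (i + 1) * b i ≤ n := by
    intro b hb i
    by_cases hi : i ∈ b.support
    · rw [← hb]
      exact Finset.single_le_sum (f := fun i => (i + 1) * b i) (fun _ _ => Nat.zero_le _) hi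
    · rw [Finsupp.notMem_support_iff.1 hi]; simp
  refine Set.Finite.of_injOn (f := fun (b : ℕ →₀ ℕ) (i : Fin (n + 1)) => b i)
    (t := Set.univ.pi fun _ => Set.Iic n) ?_ ?_ (Set.Finite.pi fun _ => Set.finite_Iic n)
  · intro b hb i _
    have := hle b hb i
    simp only [Set.mem_Iic]
    nlinarith
  · intro b hb b' hb' h
    ext i
    by_cases hi : i < n + 1
    · exact congrFun h ⟨i, hi⟩
    · have z : ∀ b : ℕ →₀ ℕ, ∑ i ∈ b.support, (i + 1) * b i = n → b i = 0 := by
        intro b hb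
        have := hle b hb i
        by_contra h0
        have : i + 1 ≤ (i + 1) * b i := Nat.le_mul_of_pos_right _ (Nat.pos_of_ne_zero h0)
        omega
      rw [z b hb, z b' hb']

noncomputable def goodEquiv {F : Type*} [Field F] (c : F) (n : ℕ) :
    {g : ℕ → F[X] // Good n g ∧ ∀ k, (g k).scaleRoots c = g k} ≃
      Σ b : {b : ℕ →₀ ℕ // ∑ i ∈ b.support, (i + 1) * b i = n}, ∀ i : b.1.support,
        {g : F[X] // g.Monic ∧ g.natDegree = b.1 i ∧ g.scaleRoots c = g} := by
  classical
  symm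
  have key : ∀ (b : ℕ →₀ ℕ) (g : ∀ i : b.support,
      {g : F[X] // g.Monic ∧ g.natDegree = b i ∧ g.scaleRoots c = g}) (k : ℕ),
      (if h : k ∈ b.support then (g ⟨k, h⟩).1 else 1).Monic ∧
      (if h : k ∈ b.support then (g ⟨k, h⟩).1 else 1).natDegree = b k ∧
      (if h : k ∈ b.support then (g ⟨k, h⟩).1 else 1).scaleRoots c =
        (if h : k ∈ b.support then (g ⟨k, h⟩).1 else 1) := by
    intro b g k
    split_ifs with h
    · exact (g ⟨k, h⟩).2
    · exact ⟨monic_one, by rw [natDegree_one, Finsupp.notMem_support_iff.1 h], one_scaleRoots _⟩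
  refine Equiv.ofBijective (fun x => ⟨fun k => if h : k ∈ x.1.1.support then (x.2 ⟨k, h⟩).1 else 1,
    ⟨fun k => (key x.1.1 x.2 k).1, x.1.1, fun k => (key x.1.1 x.2 k).2.1, x.1.2⟩,
    fun k => (key x.1.1 x.2 k).2.2⟩) ⟨?_, ?_⟩
  · rintro ⟨⟨b, hb⟩, g⟩ ⟨⟨b', hb'⟩, g'⟩ h
    have h1 := congrFun (Subtype.ext_iff.1 h)
    have hbb : b = b' := by
      ext k
      rw [← (key b g k).2.1, ← (key b' g' k).2.1]
      exact congrArg natDegree (h1 k)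
    subst hbb
    congr 1
    funext i
    apply Subtype.ext
    have := h1 i.1
    simp only [i.2, dite_true] at this
    exact this
  · rintro ⟨g, ⟨hg, b, hb, hn⟩, hs⟩
    refine ⟨⟨⟨b, hn⟩, fun i => ⟨g i.1, hg _, hb _, hs _⟩⟩, ?_⟩
    apply Subtype.ext
    funext k
    change (if h : k ∈ b.support then g k else 1) = g k
    split_ifs with h
    · rfl
    · exact ((hg k).natDegree_eq_zero.1 (by rw [hb, Finsupp.notMem_support_iff.1 h])).symm

/-- With `m` the multiplicative order of `ζ ∈ F_q^×`, the number of similarity classes of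
`n×n` matrices `B` over `F_q` with `B` similar to `ζ·B` equals the sum, over
finitely-supported sequences `(b₁, b₂, …)` of nonnegative integers with `Σᵢ i·bᵢ = n`,
of `Πᵢ q^⌊bᵢ/m⌋`. -/
theorem card_similarity_classes_fixed_by_smul {F : Type*} [Field F] [Fintype F]
    (ζ : Fˣ) (m : ℕ) (hm : m = orderOf ζ) (n : ℕ) :
    Nat.card {O : Set (Matrix (Fin n) (Fin n) F) // ∃ B : Matrix (Fin n) (Fin n) F,
        (∃ P : GL (Fin n) F, (P : Matrix (Fin n) (Fin n) F) * B *
          ((P⁻¹ : GL (Fin n) F) : Matrix (Fin n) (Fin n) F) = (ζ : F) • B) ∧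
        O = {C | ∃ P : GL (Fin n) F, C = (P : Matrix (Fin n) (Fin n) F) * B *
          ((P⁻¹ : GL (Fin n) F) : Matrix (Fin n) (Fin n) F)}} =
      ∑ᶠ (b : ℕ →₀ ℕ) (_ : ∑ i ∈ b.support, (i + 1) * b i = n),
        ∏ i ∈ b.support, Fintype.card F ^ (b i / m) := by
  rw [card_classes (ζ : F) ζ.ne_zero n, Nat.card_congr (goodEquiv (ζ : F) n)]
  have : Fintype {b : ℕ →₀ ℕ // ∑ i ∈ b.support, (i + 1) * b i = n} := (finite_weights n).fintype
  have hf : ∀ b : ℕ, Finite {g : F[X] // g.Monic ∧ g.natDegree = b ∧ g.scaleRoots (ζ : F) = g} := by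
    intro b
    apply Nat.finite_of_card_ne_zero
    rw [card_fixed ζ m hm b]
    exact pow_ne_zero _ Fintype.card_ne_zero
  rw [Nat.card_sigma]
  have h2 := finsum_set_coe_eq_finsum_mem (f := fun b : ℕ →₀ ℕ => ∏ i ∈ b.support,
    Fintype.card F ^ (b i / m)) {b : ℕ →₀ ℕ | ∑ i ∈ b.support, (i + 1) * b i = n}
  refine Eq.trans ?_ h2
  refine Eq.trans ?_ (finsum_eq_sum_of_fintype (α := {b : ℕ →₀ ℕ // ∑ i ∈ b.support, (i + 1) * b i = n}) _).symm
  refine Finset.sum_congr rfl fun b _ => ?_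
  rw [Nat.card_pi]
  simp only [card_fixed ζ m hm]
  exact Finset.prod_coe_sort b.1.support (fun i => Fintype.card F ^ (b.1 i / m))
end
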